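/- Let (A,B,C,D) be a discrete-time linear time-invariant system with state dimension n, input dimension m and output dimension p over ℝ, and assume the pair (A,B) is controllable. Let (u^d, y^d) be a length-T input-output trajectory of the system, let L ≥ 1 with L + n ≤ T, and suppose u^d is persistently exciting of order L + n. Then a pair of length-L sequences (u, y), with u : Fin L → ℝ^m and y : Fin L → ℝ^p, is an input-output trajectory of the system if and only if there exists g ∈ ℝ^{T−L+1} such that H_L(u^d) g equals the stacked vector (u_0, …, u_{L−1}) and H_L(y^d) g equals the stacked vector (y_0, …, y_{L−1}). -/

import Mathlib

open Matrix

/-- `(u, y)` is a length-`N` input-output trajectory of the discrete-time LTI system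
`(A, B, C, D)`: there is a state sequence `x` with `x (k+1) = A x k + B u k` and
`y k = C x k + D u k` for all `k < N`. -/
def IsTrajectory {n m p : ℕ} (A : Matrix (Fin n) (Fin n) ℝ) (B : Matrix (Fin n) (Fin m) ℝ)
    (C : Matrix (Fin p) (Fin n) ℝ) (D : Matrix (Fin p) (Fin m) ℝ) (N : ℕ)
    (u : Fin N → Fin m → ℝ) (y : Fin N → Fin p → ℝ) : Prop :=
  ∃ x : Fin (N + 1) → Fin n → ℝ,
    ∀ k : Fin N,
      x k.succ = A.mulVec (x k.castSucc) + B.mulVec (u k) ∧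
      y k = C.mulVec (x k.castSucc) + D.mulVec (u k)

/-- Block Hankel matrix of depth `L` built from the length-`T` sequence `u`;
its `j`-th column is the stacked window `(u j, u (j+1), …, u (j+L-1))`. -/
def hankel {T m : ℕ} (L : ℕ) (hL : L ≤ T) (u : Fin T → Fin m → ℝ) :
    Matrix (Fin L × Fin m) (Fin (T - L + 1)) ℝ :=
  fun ir j => u ⟨j.1 + ir.1.1, by have h1 := j.2; have h2 := ir.1.2; omega⟩ ir.2

/-- `u` is persistently exciting of order `L`: the depth-`L` Hankel matrix has
full row rank `L * m`. -/
def PersistentlyExciting {T m : ℕ} (L : ℕ) (hL : L ≤ T) (u : Fin T → Fin m → ℝ) : Prop :=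
  (hankel L hL u).rank = L * m

/-- `(A, B)` is controllable: the controllability matrix `[B, AB, …, A^(n-1) B]`
has rank `n`. -/
def Controllable {n m : ℕ} (A : Matrix (Fin n) (Fin n) ℝ) (B : Matrix (Fin n) (Fin m) ℝ) : Prop :=
  (Matrix.rank (fun (i : Fin n) (kj : Fin n × Fin m) => (A ^ (kj.1 : ℕ) * B) i kj.2)) = n

/-- A matrix of full row rank has trivial left kernel. -/
theorem Matrix.eq_zero_of_vecMul_eq_zero_of_rank_eq {ι κ : Type*} [Fintype ι] [Fintype κ]
    {M : Matrix ι κ ℝ} (hM : M.rank = Fintype.card ι) {v : ι → ℝ} (hv : v ᵥ* M = 0) :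
    v = 0 := by
  have hli : LinearIndependent ℝ M.row := by
    rw [linearIndependent_iff_card_eq_finrank_span, ← hM, Matrix.rank_eq_finrank_span_row]
    rfl
  exact Matrix.vecMul_injective_iff.2 hli (by simpa using hv)

/-- A matrix with trivial left kernel acts surjectively. -/
theorem Matrix.mulVec_surjective_of_vecMul_eq_zero {ι κ : Type*} [Fintype ι] [Fintype κ]
    {M : Matrix ι κ ℝ} (hM : ∀ v : ι → ℝ, v ᵥ* M = 0 → v = 0) :
    Function.Surjective M.mulVec := by
  have hinj : Function.Injective M.vecMul := by
    intro v w hvw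
    exact sub_eq_zero.1 (hM _ (by rw [Matrix.sub_vecMul, sub_eq_zero]; exact hvw))
  have hrank : M.rank = Fintype.card ι := (Matrix.vecMul_injective_iff.1 hinj).rank_matrix
  have htop : LinearMap.range M.mulVecLin = ⊤ :=
    Submodule.eq_top_of_finrank_eq (by simpa [Matrix.rank] using hrank)
  exact LinearMap.range_eq_top.1 htop

/-- Under persistent excitation of order `N`, a linear recurrence of span `N` satisfied by the
input along all data windows is trivial. -/
theorem PersistentlyExciting.eq_zero {T m N : ℕ} {hN : N ≤ T} {ud : Fin T → Fin m → ℝ}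
    (hpe : PersistentlyExciting N hN ud) {U : ℕ → Fin m → ℝ} (hU : ∀ k : Fin T, U k = ud k)
    {w : ℕ → Fin m → ℝ}
    (hw : ∀ j, j + N ≤ T → ∑ s ∈ Finset.range N, w s ⬝ᵥ U (j + s) = 0) {s : ℕ} (hs : s < N) :
    w s = 0 := by
  have hv : (fun ir : Fin N × Fin m => w ir.1 ir.2) = 0 := by
    refine Matrix.eq_zero_of_vecMul_eq_zero_of_rank_eq (M := hankel N hN ud)
      (by simpa [PersistentlyExciting] using hpe) ?_
    ext j
    have := hw j (by omega)
    rw [Finset.sum_range] at this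
    rw [Pi.zero_apply, ← this]
    simp only [Matrix.vecMul, dotProduct, Fintype.sum_prod_type, hankel, ← hU]
  ext r
  exact congrFun hv (⟨s, hs⟩, r)

/-- The left kernel of the controllability matrix of a controllable pair is trivial. -/
theorem Controllable.eq_zero {n m : ℕ} {A : Matrix (Fin n) (Fin n) ℝ}
    {B : Matrix (Fin n) (Fin m) ℝ} (h : Controllable A B) {ξ : Fin n → ℝ}
    (hξ : ∀ k < n, (ξ ᵥ* A ^ k) ᵥ* B = 0) : ξ = 0 := by
  refine Matrix.eq_zero_of_vecMul_eq_zero_of_rank_eq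
    (M := fun (i : Fin n) (kj : Fin n × Fin m) => (A ^ (kj.1 : ℕ) * B) i kj.2)
    (by simpa [Controllable] using h) ?_
  ext kj
  have := congrFun (hξ kj.1 kj.1.2) kj.2
  rwa [Matrix.vecMul_vecMul] at this

/-- The coefficients, in order of decreasing time, of the input terms obtained by pushing the
functional `(ξ, η)` on a state and the following `L` inputs forward along the dynamics. -/
def pushedCoeff {n m : ℕ} (A : Matrix (Fin n) (Fin n) ℝ) (B : Matrix (Fin n) (Fin m) ℝ) (L : ℕ)
    (ξ : Fin n → ℝ) (η : ℕ → Fin m → ℝ) (i : ℕ) : Fin m → ℝ :=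
  if i < L then η (L - 1 - i) else (ξ ᵥ* A ^ (i - L)) ᵥ* B

theorem pushedCoeff_annihilates {n m T L : ℕ} {A : Matrix (Fin n) (Fin n) ℝ}
    {B : Matrix (Fin n) (Fin m) ℝ} {U : ℕ → Fin m → ℝ} {X : ℕ → Fin n → ℝ}
    (hX : ∀ k < T, X (k + 1) = A *ᵥ X k + B *ᵥ U k) {ξ : Fin n → ℝ} {η : ℕ → Fin m → ℝ}
    (h : ∀ j, j + L ≤ T → ξ ⬝ᵥ X j + ∑ i ∈ Finset.range L, η i ⬝ᵥ U (j + i) = 0)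
    (k j : ℕ) (hj : j + (L + k) ≤ T) :
    (ξ ᵥ* A ^ k) ⬝ᵥ X j + ∑ i ∈ Finset.range (L + k),
      pushedCoeff A B L ξ η (L + k - 1 - i) ⬝ᵥ U (j + i) = 0 := by
  induction k generalizing j with
  | zero =>
    rw [← h j (by omega)]
    simp only [pow_zero, Matrix.vecMul_one, add_zero]
    congr 1
    refine Finset.sum_congr rfl fun i hi => ?_
    rw [Finset.mem_range] at hi
    rw [pushedCoeff, if_pos (by omega)]
    congr 3
    omega
  | succ k ih =>
    have hstep := ih (j + 1) (by omega)
    rw [hX j (by omega)] at hstep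
    rw [← add_assoc L k 1, Finset.sum_range_succ', ← hstep, dotProduct_add,
      Matrix.dotProduct_mulVec, Matrix.dotProduct_mulVec, Matrix.vecMul_vecMul, ← pow_succ]
    have h0 : pushedCoeff A B L ξ η (L + k + 1 - 1 - 0) = (ξ ᵥ* A ^ k) ᵥ* B := by
      simp [pushedCoeff]
    have hs : ∑ i ∈ Finset.range (L + k),
        pushedCoeff A B L ξ η (L + k + 1 - 1 - (i + 1)) ⬝ᵥ U (j + (i + 1)) =
        ∑ i ∈ Finset.range (L + k),
          pushedCoeff A B L ξ η (L + k - 1 - i) ⬝ᵥ U (j + 1 + i) := by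
      refine Finset.sum_congr rfl fun i _ => ?_
      rw [show L + k + 1 - 1 - (i + 1) = L + k - 1 - i by omega,
        show j + (i + 1) = j + 1 + i by omega]
    rw [h0, hs, add_zero]
    ring

/-- A functional on a state and the following `L` inputs which vanishes along persistently
exciting data of order `L + n` of a controllable system is zero. -/
theorem PersistentlyExciting.state_input_eq_zero {n m T L : ℕ} {hLT : L + n ≤ T}
    {A : Matrix (Fin n) (Fin n) ℝ} {B : Matrix (Fin n) (Fin m) ℝ} (hctrb : Controllable A B)
    {ud : Fin T → Fin m → ℝ} (hpe : PersistentlyExciting (L + n) hLT ud)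
    {U : ℕ → Fin m → ℝ} (hU : ∀ k : Fin T, U k = ud k) {X : ℕ → Fin n → ℝ}
    (hX : ∀ k < T, X (k + 1) = A *ᵥ X k + B *ᵥ U k) {ξ : Fin n → ℝ} {η : ℕ → Fin m → ℝ}
    (h : ∀ j, j + L ≤ T → ξ ⬝ᵥ X j + ∑ i ∈ Finset.range L, η i ⬝ᵥ U (j + i) = 0) :
    ξ = 0 ∧ ∀ i < L, η i = 0 := by
  set f := pushedCoeff A B L ξ η with hf
  let a : ℕ → ℝ := A.charpoly.coeff
  have ha : a n = 1 := by
    have h1 := A.charpoly_monic.coeff_natDegree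
    rwa [Matrix.charpoly_natDegree_eq_dim, Fintype.card_fin] at h1
  have hCH : ∑ k ∈ Finset.range (n + 1), a k • A ^ k = 0 := by
    have h1 := Matrix.aeval_self_charpoly A
    rwa [Polynomial.aeval_eq_sum_range, Matrix.charpoly_natDegree_eq_dim, Fintype.card_fin] at h1
  have hξ : ∑ k ∈ Finset.range (n + 1), a k • (ξ ᵥ* A ^ k) = 0 := by
    simp only [← Matrix.vecMul_smul, ← Matrix.vecMul_sum, hCH, Matrix.vecMul_zero]
  have hw : ∀ s < L + n, ∑ k ∈ Finset.range (n + 1),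
      a k • (if s < L + k then f (L + k - 1 - s) else 0) = 0 := by
    intro s hs
    refine hpe.eq_zero hU (w := fun s => ∑ k ∈ Finset.range (n + 1),
      a k • (if s < L + k then f (L + k - 1 - s) else 0)) (fun j hj => ?_) hs
    have hk : ∀ k ∈ Finset.range (n + 1), a k • (ξ ᵥ* A ^ k) ⬝ᵥ X j +
        ∑ s ∈ Finset.range (L + n),
          (a k • (if s < L + k then f (L + k - 1 - s) else 0)) ⬝ᵥ U (j + s) = 0 := by
      intro k hk
      rw [Finset.mem_range] at hk
      have h1 := pushedCoeff_annihilates hX h k j (by omega)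
      have h2 : ∑ s ∈ Finset.range (L + n),
          (if s < L + k then f (L + k - 1 - s) else 0) ⬝ᵥ U (j + s) =
          ∑ s ∈ Finset.range (L + k), f (L + k - 1 - s) ⬝ᵥ U (j + s) := by
        symm
        refine Finset.sum_subset_zero_on_sdiff
          (Finset.range_subset_range.2 (by omega)) ?_ ?_
        · intro s hs
          rw [Finset.mem_sdiff, Finset.mem_range, Finset.mem_range] at hs
          rw [if_neg hs.2, zero_dotProduct]
        · intro s hs
          rw [if_pos (Finset.mem_range.1 hs)]
      simp only [smul_dotProduct, ← Finset.smul_sum, ← smul_add, h2]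
      rw [h1, smul_zero]
    have hsum := Finset.sum_eq_zero hk
    rw [Finset.sum_add_distrib, Finset.sum_comm] at hsum
    simp only [← sum_dotProduct] at hsum
    rwa [hξ, zero_dotProduct, zero_add] at hsum
  have hf0 : ∀ i < L + n, f i = 0 := by
    intro i
    induction i using Nat.strong_induction_on with
    | _ i ih =>
      intro hi
      have h1 := hw (L + n - 1 - i) (by omega)
      rw [Finset.sum_range_succ, Finset.sum_eq_zero, ha, if_pos (by omega), zero_add, one_smul,
        show L + n - 1 - (L + n - 1 - i) = i by omega] at h1
      · exact h1
      · intro k hk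
        rw [Finset.mem_range] at hk
        split_ifs with hlt
        · rw [ih _ (by omega) (by omega), smul_zero]
        · rw [smul_zero]
  constructor
  · refine hctrb.eq_zero fun k hk => ?_
    simpa [hf, pushedCoeff] using hf0 (L + k) (by omega)
  · intro i hi
    have h1 := hf0 (L - 1 - i) (by omega)
    rwa [hf, pushedCoeff, if_pos (by omega), show L - 1 - (L - 1 - i) = i by omega] at h1

/-- Initial state and input sequence are jointly realized by a combination of data windows. -/
theorem PersistentlyExciting.exists_combination {n m T L : ℕ} {hLT : L + n ≤ T}
    {A : Matrix (Fin n) (Fin n) ℝ} {B : Matrix (Fin n) (Fin m) ℝ} (hctrb : Controllable A B)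
    {ud : Fin T → Fin m → ℝ} (hpe : PersistentlyExciting (L + n) hLT ud)
    {U : ℕ → Fin m → ℝ} (hU : ∀ k : Fin T, U k = ud k) {X : ℕ → Fin n → ℝ}
    (hX : ∀ k < T, X (k + 1) = A *ᵥ X k + B *ᵥ U k)
    (x₀ : Fin n → ℝ) (u : Fin L → Fin m → ℝ) :
    ∃ g : Fin (T - L + 1) → ℝ, ∑ j, g j • X j = x₀ ∧
      ∀ k : Fin L, ∑ j, g j • U (j + k) = u k := by
  let M : Matrix (Fin n ⊕ Fin L × Fin m) (Fin (T - L + 1)) ℝ := Matrix.of fun r j =>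
    Sum.elim (fun i => X j i) (fun ir => U (j + ir.1) ir.2) r
  have hM : ∀ v, v ᵥ* M = 0 → v = 0 := by
    intro v hv
    let η : ℕ → Fin m → ℝ := fun i r => if h : i < L then v (Sum.inr (⟨i, h⟩, r)) else 0
    obtain ⟨h1, h2⟩ := hpe.state_input_eq_zero hctrb hU hX
      (ξ := fun i => v (Sum.inl i)) (η := η) (by
        intro j hj
        have := congrFun hv ⟨j, by omega⟩
        rw [Pi.zero_apply] at this
        rw [← this, Finset.sum_range]
        simp [Matrix.vecMul, dotProduct, M, η, Fintype.sum_prod_type])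
    ext (i | ⟨i, r⟩)
    · exact congrFun h1 i
    · simpa [η] using congrFun (h2 i i.2) r
  obtain ⟨g, hg⟩ := Matrix.mulVec_surjective_of_vecMul_eq_zero hM
    (Sum.elim x₀ fun ir => u ir.1 ir.2)
  refine ⟨g, ?_, fun k => ?_⟩
  · ext i
    have := congrFun hg (Sum.inl i)
    simpa [Matrix.mulVec, dotProduct, M, mul_comm] using this
  · ext r
    have := congrFun hg (Sum.inr (k, r))
    simpa [Matrix.mulVec, dotProduct, M, mul_comm] using this

/-- The Hankel matrix equation in terms of combinations of shifted sequences. -/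
theorem hankel_mulVec_eq_iff {T m L : ℕ} {hL : L ≤ T} {ud : Fin T → Fin m → ℝ}
    {U : ℕ → Fin m → ℝ} (hU : ∀ k : Fin T, U k = ud k) (g : Fin (T - L + 1) → ℝ)
    (u : Fin L → Fin m → ℝ) :
    (hankel L hL ud).mulVec g = (fun ir => u ir.1 ir.2) ↔
      ∀ k : Fin L, ∑ j, g j • U (j + k) = u k := by
  simp only [funext_iff, Prod.forall, Matrix.mulVec, dotProduct, hankel, ← hU,
    Finset.sum_apply, Pi.smul_apply, smul_eq_mul, mul_comm]

/-- Willems' fundamental lemma: for a controllable LTI system and offline data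
`(u^d, y^d)` with `u^d` persistently exciting of order `L + n`, a length-`L` pair
`(u, y)` is an input-output trajectory iff it lies in the range of the stacked
Hankel matrices. -/
theorem willems_fundamental_lemma
    {n m p T L : ℕ} (hL1 : 1 ≤ L) (hLT : L + n ≤ T)
    (A : Matrix (Fin n) (Fin n) ℝ) (B : Matrix (Fin n) (Fin m) ℝ)
    (C : Matrix (Fin p) (Fin n) ℝ) (D : Matrix (Fin p) (Fin m) ℝ)
    (hctrb : Controllable A B)
    (ud : Fin T → Fin m → ℝ) (yd : Fin T → Fin p → ℝ)
    (hdata : IsTrajectory A B C D T ud yd)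
    (hpe : PersistentlyExciting (L + n) (by omega) ud)
    (u : Fin L → Fin m → ℝ) (y : Fin L → Fin p → ℝ) :
    IsTrajectory A B C D L u y ↔
      ∃ g : Fin (T - L + 1) → ℝ,
        (hankel L (by omega) ud).mulVec g = (fun ir => u ir.1 ir.2) ∧
        (hankel L (by omega) yd).mulVec g = (fun ir => y ir.1 ir.2) := by
  obtain ⟨xd, hxd⟩ := hdata
  let U : ℕ → Fin m → ℝ := fun k => if h : k < T then ud ⟨k, h⟩ else 0
  let Y : ℕ → Fin p → ℝ := fun k => if h : k < T then yd ⟨k, h⟩ else 0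
  let X : ℕ → Fin n → ℝ := fun k => if h : k < T + 1 then xd ⟨k, h⟩ else 0
  have hU : ∀ k : Fin T, U k = ud k := fun k => by simp [U]
  have hY : ∀ k : Fin T, Y k = yd k := fun k => by simp [Y]
  have hXd : ∀ k : Fin (T + 1), X k = xd k := fun k => dif_pos k.2
  have hX : ∀ k < T, X (k + 1) = A *ᵥ X k + B *ᵥ U k := fun k hk => by
    have h1 := (hxd ⟨k, hk⟩).1
    rwa [← hXd, ← hXd, ← hU] at h1
  have hYX : ∀ k < T, Y k = C *ᵥ X k + D *ᵥ U k := fun k hk => by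
    have h1 := (hxd ⟨k, hk⟩).2
    rwa [← hXd, ← hY, ← hU] at h1
  have hstate : ∀ (g : Fin (T - L + 1) → ℝ), ∀ k < L, ∑ j, g j • X (j + (k + 1)) =
      A *ᵥ (∑ j, g j • X (j + k)) + B *ᵥ (∑ j, g j • U (j + k)) := by
    intro g k hk
    simp only [Matrix.mulVec_sum, Matrix.mulVec_smul, ← Finset.sum_add_distrib, ← smul_add]
    refine Finset.sum_congr rfl fun j _ => ?_
    rw [← hX _ (by omega), add_assoc]
  have hout : ∀ (g : Fin (T - L + 1) → ℝ), ∀ k < L, ∑ j, g j • Y (j + k) =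
      C *ᵥ (∑ j, g j • X (j + k)) + D *ᵥ (∑ j, g j • U (j + k)) := by
    intro g k hk
    simp only [Matrix.mulVec_sum, Matrix.mulVec_smul, ← Finset.sum_add_distrib, ← smul_add]
    refine Finset.sum_congr rfl fun j _ => ?_
    rw [← hYX _ (by omega)]
  simp only [hankel_mulVec_eq_iff hU, hankel_mulVec_eq_iff hY]
  constructor
  · rintro ⟨x, hx⟩
    obtain ⟨g, hg0, hgu⟩ := hpe.exists_combination hctrb hU hX (x 0) u
    have hgx : ∀ k : Fin (L + 1), ∑ j, g j • X (j + k) = x k := by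
      intro k
      induction k using Fin.induction with
      | zero => simpa using hg0
      | succ k ih =>
        rw [Fin.val_castSucc] at ih
        rw [Fin.val_succ, hstate g k k.2, ih, hgu, (hx k).1]
    refine ⟨g, hgu, fun k => ?_⟩
    rw [hout g k k.2, hgu, (hx k).2, ← hgx, Fin.val_castSucc]
  · rintro ⟨g, hgu, hgy⟩
    refine ⟨fun k => ∑ j, g j • X (j + k), fun k => ⟨?_, ?_⟩⟩
    · rw [← hgu]
      exact hstate g k k.2
    · rw [← hgu, ← hgy]
      exact hout g k k.2
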